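/- arXiv:1504.03850 — 2 statements merged into one kernel-verified Lean document; each statement's English description precedes it below -/
import Mathlib

section
/- Let r = 2 and let the data (v_1, …, v_m; 𝓙) be a simplicial complete fan in ℝ^n with m = n + 2 ray generators, and let Q be a Gale dual matrix of V with columns q_1, …, q_m ∈ ℝ². Then there exists a *minimal* member I₀ ∈ 𝓘, i.e. one such that no column q_i (1 ≤ i ≤ m) lies in the relative interior of the cone ⟨Q_{I₀}⟩. -/
open Finset Matrix

/-- The cone generated by the vectors `v i`, `i ∈ S`: all nonnegative linear combinations. -/
def coneOf {m d : ℕ} (v : Fin m → (Fin d → ℝ)) (S : Finset (Fin m)) : Set (Fin d → ℝ) :=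
  {x | ∃ c : Fin m → ℝ, (∀ i, 0 ≤ c i) ∧ (∀ i ∉ S, c i = 0) ∧ x = ∑ i, c i • v i}

/-- The data of a simplicial complete fan in ℝ^n with `m` ray generators `v i` and
collection `𝓙` of maximal cones (as `n`-element index sets). -/
def IsSimplicialCompleteFan {n m : ℕ} (v : Fin m → (Fin n → ℝ))
    (𝓙 : Set (Finset (Fin m))) : Prop :=
  (∀ i, v i ≠ 0) ∧
  (∀ i j : Fin m, i ≠ j → ∀ t : ℝ, 0 ≤ t → v i ≠ t • v j) ∧
  𝓙.Nonempty ∧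
  (∀ J ∈ 𝓙, J.card = n) ∧
  (∀ i : Fin m, ∃ J ∈ 𝓙, i ∈ J) ∧
  (∀ J ∈ 𝓙, LinearIndependent ℝ (fun j : J => v j)) ∧
  (∀ J ∈ 𝓙, ∀ J' ∈ 𝓙, coneOf v J ∩ coneOf v J' = coneOf v (J ∩ J')) ∧
  (⋃ J ∈ 𝓙, coneOf v J) = Set.univ


/-- The positive combinations of the vectors `v i`, `i ∈ S`. -/
def openConeOf {m d : ℕ} (v : Fin m → (Fin d → ℝ)) (S : Finset (Fin m)) : Set (Fin d → ℝ) :=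
  {x | ∃ c : Fin m → ℝ, (∀ i ∈ S, 0 < c i) ∧ (∀ i ∉ S, c i = 0) ∧ x = ∑ i, c i • v i}

/-- A point of the intrinsic interior of `s` can be pushed slightly away from any point of `s`. -/
theorem exists_pos_sub_smul_mem_of_mem_intrinsicInterior {E : Type*} [NormedAddCommGroup E]
    [NormedSpace ℝ E] {s : Set E} {x y : E} (hx : x ∈ intrinsicInterior ℝ s) (hy : y ∈ s) :
    ∃ ε : ℝ, 0 < ε ∧ x - ε • (y - x) ∈ s := by
  obtain ⟨z, hz, rfl⟩ := hx
  let f : ℝ → affineSpan ℝ s := fun t =>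
    ⟨AffineMap.lineMap (z : E) y (-t), AffineMap.lineMap_mem _ z.2 (subset_affineSpan ℝ s hy)⟩
  have hf : ∀ t, (f t : E) = (z : E) - t • (y - z) := fun t => by
    simp only [f, AffineMap.lineMap_apply, vsub_eq_sub, vadd_eq_add]
    module
  have hcont : Continuous f := by
    refine Continuous.subtype_mk (f := fun t : ℝ => (f t : E)) ?_ (fun t => (f t).2)
    simp only [hf]
    fun_prop
  have h0 : f 0 = z := Subtype.ext (by simp [hf])
  have hev : ∀ᶠ t in nhds (0 : ℝ), f t ∈ interior ((↑) ⁻¹' s : Set (affineSpan ℝ s)) :=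
    hcont.continuousAt.eventually (by rw [h0]; exact isOpen_interior.mem_nhds hz)
  obtain ⟨t, ht, htpos⟩ :=
    ((hev.filter_mono nhdsWithin_le_nhds).and (self_mem_nhdsWithin (s := Set.Ioi (0 : ℝ)))).exists
  exact ⟨t, htpos, by simpa [hf] using interior_subset ht⟩

theorem intrinsicInterior_coneOf_subset {m d : ℕ} (v : Fin m → (Fin d → ℝ))
    (S : Finset (Fin m)) : intrinsicInterior ℝ (coneOf v S) ⊆ openConeOf v S := by
  classical
  intro x hx
  obtain ⟨c, hc0, hcS, hxc⟩ := intrinsicInterior_subset hx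
  have hy : x + ∑ i, (if i ∈ S then (1 : ℝ) else 0) • v i ∈ coneOf v S := by
    refine ⟨fun i => c i + if i ∈ S then 1 else 0, fun i => ?_, fun i hi => ?_, ?_⟩
    · have := hc0 i
      dsimp only
      split_ifs <;> linarith
    · simp [hi, hcS i hi]
    · simp only [add_smul, Finset.sum_add_distrib, ← hxc]
  obtain ⟨ε, hε, e, he0, heS, hxe⟩ := exists_pos_sub_smul_mem_of_mem_intrinsicInterior hx hy
  refine ⟨fun i => e i + ε * if i ∈ S then 1 else 0, fun i hi => ?_, fun i hi => ?_, ?_⟩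
  · have := he0 i
    simp only [hi, if_true]
    linarith
  · simp [hi, heS i hi]
  · simp only [add_smul, Finset.sum_add_distrib, ← hxe, mul_smul, ← Finset.smul_sum]
    module

theorem eq_of_sum_smul_eq {m d : ℕ} {v : Fin m → (Fin d → ℝ)} {S : Finset (Fin m)}
    (hv : LinearIndependent ℝ (fun j : S => v j)) {c e : Fin m → ℝ} (hc : ∀ i ∉ S, c i = 0)
    (he : ∀ i ∉ S, e i = 0) (h : ∑ i, c i • v i = ∑ i, e i • v i) : c = e := by
  have hsum : ∑ i ∈ S, (c i - e i) • v i = 0 := by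
    rw [Finset.sum_subset (Finset.subset_univ S)
      (fun i _ hi => by simp [hc i hi, he i hi])]
    simp [sub_smul, h]
  have key := Fintype.linearIndependent_iff.1 hv (fun j => c j - e j)
    (by rw [← hsum, ← Finset.sum_coe_sort S (fun i => (c i - e i) • v i)])
  funext i
  by_cases hi : i ∈ S
  · exact sub_eq_zero.1 (key ⟨i, hi⟩)
  · rw [hc i hi, he i hi]

theorem isClosed_coneOf {m d : ℕ} {v : Fin m → (Fin d → ℝ)} {S : Finset (Fin m)}
    (hv : LinearIndependent ℝ (fun j : S => v j)) : IsClosed (coneOf v S) := by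
  classical
  have hinj := linearIndependent_iff_injective_fintypeLinearCombination.1 hv
  have himage : coneOf v S =
      Fintype.linearCombination ℝ (fun j : S => v j) '' {c | ∀ j, 0 ≤ c j} := by
    ext x
    constructor
    · rintro ⟨c, hc0, hcS, rfl⟩
      refine ⟨fun j => c j, fun j => hc0 j, ?_⟩
      rw [Fintype.linearCombination_apply, Finset.sum_coe_sort S (fun i => c i • v i)]
      exact Finset.sum_subset (Finset.subset_univ S) (fun i _ hi => by simp [hcS i hi])
    · rintro ⟨c, hc0, rfl⟩
      refine ⟨fun i => if h : i ∈ S then c ⟨i, h⟩ else 0, fun i => ?_, fun i hi => by simp [hi],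
        ?_⟩
      · dsimp only
        split_ifs
        exacts [hc0 _, le_rfl]
      · rw [Fintype.linearCombination_apply, ← Finset.sum_subset (Finset.subset_univ S)
          (fun i _ hi => by simp [hi]), ← Finset.sum_coe_sort S]
        exact Finset.sum_congr rfl (fun j _ => by simp)
  rw [himage]
  refine (LinearMap.isClosedEmbedding_of_injective (LinearMap.ker_eq_bot.2 hinj)).isClosedMap _ ?_
  simp only [Set.ofPred_forall]
  exact isClosed_iInter fun j => isClosed_le continuous_const (continuous_apply j)

/-- Every wall of a maximal cone of a simplicial complete fan is shared with another maximal
cone. -/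
theorem IsSimplicialCompleteFan.exists_adjacent {n m : ℕ} {v : Fin m → (Fin n → ℝ)}
    {𝓙 : Set (Finset (Fin m))} (h : IsSimplicialCompleteFan v 𝓙) {J : Finset (Fin m)}
    (hJ : J ∈ 𝓙) {i : Fin m} (hi : i ∈ J) : ∃ J' ∈ 𝓙, J.erase i ⊆ J' ∧ i ∉ J' := by
  classical
  obtain ⟨-, -, -, hcard, -, hind, hinter, hcover⟩ := h
  let w : Fin m → ℝ := fun j => if j ∈ J.erase i then 1 else 0
  have hwJ : ∀ j ∉ J, w j = 0 := fun j hj =>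
    if_neg fun hj' => hj (Finset.mem_of_mem_erase hj')
  have hw0 : ∀ j, 0 ≤ w j := fun j => by
    dsimp only [w]
    split_ifs <;> norm_num
  let p := ∑ j, w j • v j
  have hev : ∀ᶠ ε in nhdsWithin (0 : ℝ) (Set.Ioi 0), ∀ J' : Finset (Fin m), J' ∈ 𝓙 →
      p ∉ coneOf v J' → p - ε • v i ∉ coneOf v J' := by
    rw [Filter.eventually_all]
    intro J'
    by_cases hJ' : J' ∈ 𝓙 ∧ p ∉ coneOf v J'
    · have hcont : Continuous fun ε : ℝ => p - ε • v i := by fun_prop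
      have hmem := (hcont.continuousAt (x := 0)).eventually
        ((isClosed_coneOf (hind J' hJ'.1)).isOpen_compl.mem_nhds (by simpa using hJ'.2))
      exact (hmem.filter_mono nhdsWithin_le_nhds).mono fun ε hε _ _ => hε
    · exact Filter.Eventually.of_forall fun ε h1 h2 => absurd ⟨h1, h2⟩ hJ'
  obtain ⟨ε, hε, hεpos⟩ := (hev.and self_mem_nhdsWithin).exists
  have hmem : p - ε • v i ∈ ⋃ J ∈ 𝓙, coneOf v J := hcover ▸ Set.mem_univ _
  simp only [Set.mem_iUnion] at hmem
  obtain ⟨J', hJ', hpε⟩ := hmem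
  have hpJ' : p ∈ coneOf v J' := by
    by_contra hp
    exact hε J' hJ' hp hpε
  have hpJ : p ∈ coneOf v J := ⟨w, hw0, hwJ, rfl⟩
  obtain ⟨c, -, hcS, hpc⟩ := hinter J hJ J' hJ' ▸ Set.mem_inter hpJ hpJ'
  have hcw : w = c := eq_of_sum_smul_eq (hind J hJ) hwJ
    (fun j hj => hcS j fun hj' => hj (Finset.mem_inter.1 hj').1) hpc
  have hsub : J.erase i ⊆ J' := by
    intro j hj
    by_contra hjJ'
    have h0 := hcS j fun hj' => hjJ' (Finset.mem_inter.1 hj').2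
    rw [← hcw] at h0
    simp only [w, if_pos hj] at h0
    norm_num at h0
  refine ⟨J', hJ', hsub, fun hiJ' => ?_⟩
  have hJJ' : J = J' := by
    refine Finset.eq_of_subset_of_card_le ?_ (by rw [hcard J hJ, hcard J' hJ'])
    rw [← Finset.insert_erase hi]
    exact Finset.insert_subset hiJ' hsub
  subst hJJ'
  obtain ⟨e, he0, heJ, hpe⟩ := hpε
  have hwe : (fun j => w j - ε * Pi.single (M := fun _ => ℝ) i 1 j) = e := by
    refine eq_of_sum_smul_eq (hind J hJ) (fun j hj => ?_) heJ ?_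
    · have hji : j ≠ i := fun hji => hj (hji ▸ hi)
      simp [hwJ j hj, hji]
    · rw [← hpe]
      simp [sub_smul, p, Pi.single_apply]
  have hei := he0 i
  rw [← hwe] at hei
  simp only [w, Finset.notMem_erase, if_false, Pi.single_eq_same] at hei
  have : 0 < ε := hεpos
  linarith

/-- Gale duality: if the columns of `V` indexed by `J` form a basis, then the columns of the Gale
dual matrix indexed by the complement of `J` are linearly independent. -/
theorem linearIndependent_compl_of_gale {n r m : ℕ} (hm : m = n + r)
    (V : Matrix (Fin n) (Fin m) ℝ) (Q : Matrix (Fin r) (Fin m) ℝ) (hQrank : Q.rank = r)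
    (hQV : Q * Vᵀ = 0) {J : Finset (Fin m)} (hcard : J.card = n)
    (hJ : LinearIndependent ℝ (fun j : J => fun a => V a j)) :
    LinearIndependent ℝ (fun i : ((Jᶜ : Finset (Fin m))) => fun a => Q a i) := by
  classical
  have hspan : Submodule.span ℝ (Set.range fun j : J => fun a => V a j) = ⊤ :=
    hJ.span_eq_top_of_card_eq_finrank' (by simp [hcard])
  have hzero : ∀ y : Fin n → ℝ, (∀ j ∈ J, (Vᵀ *ᵥ y) j = 0) → y = 0 := by
    intro y hy
    refine dotProduct_eq_zero y fun w => ?_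
    have hw : w ∈ Submodule.span ℝ (Set.range fun j : J => fun a => V a j) := hspan ▸ trivial
    induction hw using Submodule.span_induction with
    | mem x hx =>
      obtain ⟨j, rfl⟩ := hx
      rw [dotProduct_comm]
      exact hy j j.2
    | zero => simp
    | add a b _ _ ha hb => rw [dotProduct_add, ha, hb, add_zero]
    | smul t a _ ha => rw [dotProduct_smul, ha, smul_zero]
  have hinj : Function.Injective Vᵀ.mulVecLin := by
    rw [← LinearMap.ker_eq_bot, LinearMap.ker_eq_bot']
    intro y hy
    exact hzero y fun j _ => congrFun hy j
  have hrange : LinearMap.range Vᵀ.mulVecLin = LinearMap.ker Q.mulVecLin := by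
    refine Submodule.eq_of_le_of_finrank_eq ?_ ?_
    · rintro _ ⟨y, rfl⟩
      rw [LinearMap.mem_ker, Matrix.mulVecLin_apply, Matrix.mulVecLin_apply,
        Matrix.mulVec_mulVec, hQV, Matrix.zero_mulVec]
    · have hrn := Q.mulVecLin.finrank_range_add_finrank_ker
      have hQ : Module.finrank ℝ (LinearMap.range Q.mulVecLin) = r := hQrank
      rw [LinearMap.finrank_range_of_inj hinj]
      simp only [Module.finrank_fin_fun] at hrn ⊢
      omega
  rw [Fintype.linearIndependent_iff]
  intro g hg
  let c : Fin m → ℝ := fun i => if h : i ∈ Jᶜ then g ⟨i, h⟩ else 0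
  have hc : c ∈ LinearMap.ker Q.mulVecLin := by
    rw [LinearMap.mem_ker, ← hg]
    ext a
    rw [Matrix.mulVecLin_apply, Matrix.mulVec, dotProduct, Finset.sum_apply,
      ← Finset.sum_subset (Finset.subset_univ Jᶜ)
        (fun i _ hi => by simp only [c, dif_neg hi, mul_zero]),
      ← Finset.sum_coe_sort Jᶜ]
    refine Finset.sum_congr rfl fun i _ => ?_
    simp only [c, dif_pos i.2, Pi.smul_apply, smul_eq_mul, mul_comm]
  rw [← hrange] at hc
  obtain ⟨y, hy⟩ := hc
  have hy0 : y = 0 := hzero y fun j hj => by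
    rw [← Matrix.mulVecLin_apply, hy]
    simp [c, hj]
  intro i
  have hci := congrFun hy i
  rw [hy0, map_zero] at hci
  simpa only [c, dif_pos i.2, Pi.zero_apply] using hci.symm

theorem notMem_openConeOf_of_mem {m d : ℕ} {v : Fin m → (Fin d → ℝ)} {S : Finset (Fin m)}
    (hv : LinearIndependent ℝ (fun j : S => v j)) (hS : 1 < S.card) {i : Fin m} (hi : i ∈ S) :
    v i ∉ openConeOf v S := by
  classical
  rintro ⟨c, hcpos, hcS, hic⟩
  obtain ⟨k, hk, hki⟩ := Finset.exists_mem_ne hS i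
  have hc : Pi.single i 1 = c := eq_of_sum_smul_eq hv
    (fun j hj => Pi.single_eq_of_ne (fun hji : j = i => hj (hji ▸ hi)) _) hcS
    (by rw [← hic]; simp [Pi.single_apply])
  have := hcpos k hk
  rw [← hc, Pi.single_eq_of_ne hki] at this
  exact lt_irrefl _ this

/-- Replacing a generator by a positive combination of all generators shrinks the open cone. -/
theorem openConeOf_subset_of_mem {m d : ℕ} {v : Fin m → (Fin d → ℝ)} {S T : Finset (Fin m)}
    {i : Fin m} (hiS : i ∉ S) (hiT : i ∈ T) (hTS : T ⊆ insert i S)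
    (hi : v i ∈ openConeOf v S) : openConeOf v T ⊆ openConeOf v S := by
  classical
  rintro _ ⟨c, hcpos, hcT, rfl⟩
  obtain ⟨e, hepos, heS, hie⟩ := hi
  refine ⟨fun j => c j - c i * Pi.single (M := fun _ => ℝ) i 1 j + c i * e j, fun j hj => ?_,
    fun j hj => ?_, ?_⟩
  · have hji : j ≠ i := fun hji => hiS (hji ▸ hj)
    have hcj : 0 ≤ c j := by
      by_cases hjT : j ∈ T
      · exact (hcpos j hjT).le
      · exact (hcT j hjT).ge
    have := mul_pos (hcpos i hiT) (hepos j hj)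
    simp only [Pi.single_eq_of_ne hji]
    linarith
  · rcases eq_or_ne j i with rfl | hji
    · simp [heS j hj]
    · have hjT : j ∉ T := fun hjT => (Finset.mem_insert.1 (hTS hjT)).elim hji hj
      simp [hji, heS j hj, hcT j hjT]
  · simp only [add_smul, sub_smul, mul_smul, Finset.sum_add_distrib, Finset.sum_sub_distrib,
      ← Finset.smul_sum, ← hie]
    simp [Pi.single_apply]

theorem stmt_6 {n : ℕ} (hn : 1 ≤ n) {m : ℕ} (hm : m = n + 2)
    (V : Matrix (Fin n) (Fin m) ℝ) (Q : Matrix (Fin 2) (Fin m) ℝ)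
    (𝓙 : Set (Finset (Fin m)))
    (hfan : IsSimplicialCompleteFan (fun i a => V a i) 𝓙)
    (hQrank : Q.rank = 2) (hQV : Q * Vᵀ = 0)
    (𝓘 : Set (Finset (Fin m))) (h𝓘 : 𝓘 = {I | ∃ J ∈ 𝓙, I = Jᶜ}) :
    ∃ I₀ ∈ 𝓘, ∀ i : Fin m,
      (fun a => Q a i) ∉ intrinsicInterior ℝ (coneOf (fun i a => Q a i) I₀) := by
  classical
  have hfan' := hfan
  obtain ⟨-, -, hne, hcard, -, hind, -, -⟩ := hfan'
  let q : Fin m → Fin 2 → ℝ := fun i a => Q a i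
  have hq : ∀ J ∈ 𝓙, ∀ i ∈ Jᶜ, q i ∉ openConeOf q Jᶜ := fun J hJ i hi =>
    notMem_openConeOf_of_mem
      (linearIndependent_compl_of_gale hm V Q hQrank hQV (hcard J hJ) (hind J hJ))
      (by rw [Finset.card_compl, hcard J hJ, Fintype.card_fin]; omega) hi
  obtain ⟨J, hJ, hmin⟩ := Set.exists_min_image 𝓙
    (fun J => #{i | q i ∈ openConeOf q Jᶜ}) (Set.toFinite _) hne
  refine ⟨Jᶜ, h𝓘 ▸ ⟨J, hJ, rfl⟩, fun i hi => ?_⟩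
  have hiq : q i ∈ openConeOf q Jᶜ := intrinsicInterior_coneOf_subset _ _ hi
  have hiJ : i ∈ J := by
    by_contra hiJ
    exact hq J hJ i (Finset.mem_compl.2 hiJ) hiq
  obtain ⟨J', hJ', hsub, hiJ'⟩ := hfan.exists_adjacent hJ hiJ
  have hsubset : openConeOf q J'ᶜ ⊆ openConeOf q Jᶜ := by
    refine openConeOf_subset_of_mem (by simpa using hiJ) (Finset.mem_compl.2 hiJ') ?_ hiq
    rw [← Finset.compl_erase]
    exact Finset.compl_subset_compl.2 hsub
  refine (hmin J' hJ').not_gt (Finset.card_lt_card ?_)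
  refine Finset.ssubset_iff_of_subset (fun j hj => ?_) |>.2 ⟨i, ?_, ?_⟩
  · simp only [Finset.mem_filter, Finset.mem_univ, true_and] at hj ⊢
    exact hsubset hj
  · simpa using hiq
  · simpa using hq J' hJ' i (Finset.mem_compl.2 hiJ')
end

section
/- Let r = 2 and let the data (v_1, …, v_m; 𝓙) be a simplicial complete fan in ℝ^n with m = n + 2 ray generators, and let Q be a Gale dual matrix of V with columns q_1, …, q_m ∈ ℝ². Then there exists I₀ ∈ 𝓘 such that ⋂_{I ∈ 𝓘} ⟨Q_I⟩ = ⟨Q_{I₀}⟩; in other words, the intersection of all the cones of the bunch is itself one of the cones generated by a pair of columns of Q indexed by a member of 𝓘. -/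
open Finset Matrix

/-- A point lies in the cone of the columns of `A` indexed by `S` iff it is the image under `A` of
a nonnegative vector supported on `S`. -/
theorem mem_coneOf_col {m d : ℕ} {A : Matrix (Fin d) (Fin m) ℝ} {S : Finset (Fin m)}
    {x : Fin d → ℝ} :
    x ∈ coneOf (fun i a => A a i) S ↔
      ∃ c : Fin m → ℝ, (∀ i, 0 ≤ c i) ∧ (∀ i ∉ S, c i = 0) ∧ x = A *ᵥ c := by
  have h (c : Fin m → ℝ) : ∑ i, c i • (fun a => A a i) = A *ᵥ c := by
    ext a
    simp [Matrix.mulVec, dotProduct, Finset.sum_apply, mul_comm]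
  simp only [coneOf, Set.mem_ofPred_eq, h]

theorem coneOf_add_mem {m d : ℕ} {v : Fin m → (Fin d → ℝ)} {S : Finset (Fin m)}
    {x y : Fin d → ℝ} (hx : x ∈ coneOf v S) (hy : y ∈ coneOf v S) : x + y ∈ coneOf v S := by
  obtain ⟨a, ha, ha', rfl⟩ := hx
  obtain ⟨b, hb, hb', rfl⟩ := hy
  refine ⟨a + b, fun i => add_nonneg (ha i) (hb i), fun i hi => ?_, ?_⟩
  · simp [ha' i hi, hb' i hi]
  · simp [add_smul, Finset.sum_add_distrib]

theorem coneOf_smul_mem {m d : ℕ} {v : Fin m → (Fin d → ℝ)} {S : Finset (Fin m)}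
    {x : Fin d → ℝ} {t : ℝ} (ht : 0 ≤ t) (hx : x ∈ coneOf v S) : t • x ∈ coneOf v S := by
  obtain ⟨a, ha, ha', rfl⟩ := hx
  refine ⟨t • a, fun i => mul_nonneg ht (ha i), fun i hi => ?_, ?_⟩
  · simp [ha' i hi]
  · simp [Finset.smul_sum, mul_smul]

theorem coneOf_generator_mem {m d : ℕ} (v : Fin m → (Fin d → ℝ)) {S : Finset (Fin m)}
    {i : Fin m} (hi : i ∈ S) : v i ∈ coneOf v S := by
  refine ⟨Pi.single i 1, fun j => ?_, fun j hj => ?_, ?_⟩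
  · by_cases h : j = i
    · subst h; simp
    · simp [h]
  · have h : j ≠ i := fun h => hj (h ▸ hi)
    simp [h]
  · simp [Pi.single_apply, ite_smul]

/-- The cone over a set of generators is the least cone containing them. -/
theorem coneOf_subset_coneOf {m d : ℕ} {v : Fin m → (Fin d → ℝ)} {S T : Finset (Fin m)}
    (h : ∀ i ∈ S, v i ∈ coneOf v T) : coneOf v S ⊆ coneOf v T := by
  rintro x ⟨c, hc, hc', rfl⟩
  refine Finset.sum_induction _ (· ∈ coneOf v T) (fun _ _ => coneOf_add_mem)
    ⟨0, by simp, by simp, by simp⟩ fun i _ => ?_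
  by_cases hi : i ∈ S
  · exact coneOf_smul_mem (hc i) (h i hi)
  · exact ⟨0, by simp, by simp, by simp [hc' i hi]⟩

/-- A linear form which is nonnegative on the generators is nonnegative on the cone. -/
theorem dotProduct_nonneg_of_mem_coneOf {m d : ℕ} {v : Fin m → (Fin d → ℝ)}
    {S : Finset (Fin m)} {x z : Fin d → ℝ} (hx : x ∈ coneOf v S)
    (hz : ∀ i ∈ S, 0 ≤ z ⬝ᵥ v i) : 0 ≤ z ⬝ᵥ x := by
  obtain ⟨c, hc, hc', rfl⟩ := hx
  rw [dotProduct_sum]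
  refine Finset.sum_nonneg fun i _ => ?_
  rw [dotProduct_smul, smul_eq_mul]
  by_cases hi : i ∈ S
  · exact mul_nonneg (hc i) (hz i hi)
  · simp [hc' i hi]

theorem mulVec_vecMul_eq_zero {n m r : ℕ} {V : Matrix (Fin n) (Fin m) ℝ}
    {Q : Matrix (Fin r) (Fin m) ℝ} (hQV : Q * Vᵀ = 0) (z : Fin r → ℝ) : V *ᵥ (z ᵥ* Q) = 0 := by
  rw [← Matrix.vecMul_transpose, Matrix.vecMul_vecMul, hQV, Matrix.vecMul_zero]

/-- If `Q * Vᵀ = 0` and the ranks of `Q` and `V` are complementary, then the row space of `Q` is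
the whole kernel of `V`. -/
theorem exists_vecMul_eq_of_mulVec_eq_zero {n m r : ℕ} {V : Matrix (Fin n) (Fin m) ℝ}
    {Q : Matrix (Fin r) (Fin m) ℝ} (hQV : Q * Vᵀ = 0) (hrank : Q.rank + V.rank = m)
    {x : Fin m → ℝ} (hx : V *ᵥ x = 0) : ∃ z, z ᵥ* Q = x := by
  have hle : LinearMap.range Qᵀ.mulVecLin ≤ LinearMap.ker V.mulVecLin := by
    rintro _ ⟨z, rfl⟩
    simpa [Matrix.mulVec_transpose] using mulVec_vecMul_eq_zero hQV z
  have hdim := LinearMap.finrank_range_add_finrank_ker V.mulVecLin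
  have hQ : Module.finrank ℝ (LinearMap.range Qᵀ.mulVecLin) = Q.rank := Q.rank_transpose
  have hV : Module.finrank ℝ (LinearMap.range V.mulVecLin) = V.rank := rfl
  rw [Module.finrank_fin_fun] at hdim
  have heq := Submodule.eq_of_le_of_finrank_eq hle (by omega)
  have hmem : x ∈ LinearMap.range Qᵀ.mulVecLin := by
    rw [heq]
    simpa using hx
  obtain ⟨z, hz⟩ := hmem
  exact ⟨z, by simpa [Matrix.mulVec_transpose] using hz⟩

theorem eq_zero_of_vecMul_eq_zero_of_rank_eq {m r : ℕ} {Q : Matrix (Fin r) (Fin m) ℝ}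
    (hQ : Q.rank = r) {z : Fin r → ℝ} (hz : z ᵥ* Q = 0) : z = 0 := by
  have hdim := LinearMap.finrank_range_add_finrank_ker Qᵀ.mulVecLin
  have hr : Module.finrank ℝ (LinearMap.range Qᵀ.mulVecLin) = Q.rank := Q.rank_transpose
  rw [Module.finrank_fin_fun] at hdim
  have hker : LinearMap.ker Qᵀ.mulVecLin = ⊥ := Submodule.finrank_eq_zero.mp (by omega)
  have hmem : z ∈ LinearMap.ker Qᵀ.mulVecLin := by
    simpa [Matrix.mulVec_transpose] using hz
  rwa [hker, Submodule.mem_bot] at hmem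

/-- If the columns indexed by `J` are linearly independent, a vector supported on `J` is
determined by its image. -/
theorem eq_of_mulVec_eq_of_linearIndependent {n m : ℕ} {V : Matrix (Fin n) (Fin m) ℝ}
    {J : Finset (Fin m)} (hJ : LinearIndependent ℝ (fun j : J => (fun a => V a j)))
    {a b : Fin m → ℝ} (ha : ∀ i ∉ J, a i = 0) (hb : ∀ i ∉ J, b i = 0)
    (hab : V *ᵥ a = V *ᵥ b) : a = b := by
  have hsum : ∑ j : J, (a j - b j) • (fun k => V k j) = 0 := by
    rw [Finset.sum_coe_sort J (fun j => (a j - b j) • (fun k => V k j)),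
      Finset.sum_subset (Finset.subset_univ J)]
    · ext k
      have := congrFun hab k
      simp only [Matrix.mulVec, dotProduct] at this
      simp [Finset.sum_apply, mul_sub, mul_comm _ (V k _), this]
    · intro i _ hi
      simp [ha i hi, hb i hi]
  ext i
  by_cases hi : i ∈ J
  · exact sub_eq_zero.mp (Fintype.linearIndependent_iff.mp hJ _ hsum ⟨i, hi⟩)
  · rw [ha i hi, hb i hi]

section Fan

variable {n m : ℕ} {V : Matrix (Fin n) (Fin m) ℝ} {𝓙 : Set (Finset (Fin m))}

theorem IsSimplicialCompleteFan.exists_mem_coneOf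
    (hfan : IsSimplicialCompleteFan (fun i a => V a i) 𝓙) (x : Fin n → ℝ) :
    ∃ J ∈ 𝓙, ∃ c : Fin m → ℝ, (∀ i, 0 ≤ c i) ∧ (∀ i ∉ J, c i = 0) ∧ x = V *ᵥ c := by
  have hx : x ∈ ⋃ J ∈ 𝓙, coneOf (fun i a => V a i) J := by
    rw [hfan.2.2.2.2.2.2.2]
    trivial
  simpa only [Set.mem_iUnion, exists_prop, mem_coneOf_col] using hx

theorem IsSimplicialCompleteFan.rank_eq
    (hfan : IsSimplicialCompleteFan (fun i a => V a i) 𝓙) : V.rank = n := by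
  have hsurj : LinearMap.range V.mulVecLin = ⊤ := by
    rw [LinearMap.range_eq_top]
    intro x
    obtain ⟨J, -, c, -, -, hc⟩ := hfan.exists_mem_coneOf x
    exact ⟨c, by simp [hc]⟩
  rw [Matrix.rank, hsurj, finrank_top, Module.finrank_fin_fun]

/-- The rays of a complete fan satisfy a linear relation with positive coefficients. -/
theorem IsSimplicialCompleteFan.exists_pos_relation
    (hfan : IsSimplicialCompleteFan (fun i a => V a i) 𝓙) :
    ∃ c : Fin m → ℝ, (∀ i, 0 < c i) ∧ V *ᵥ c = 0 := by
  obtain ⟨J, -, c, hc, -, hx⟩ := hfan.exists_mem_coneOf (-(V *ᵥ 1))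
  refine ⟨1 + c, fun i => add_pos_of_pos_of_nonneg one_pos (hc i), ?_⟩
  rw [Matrix.mulVec_add, ← hx, add_neg_cancel]

/-- A relation among the rays of a simplicial fan which is nonpositive outside one maximal cone
and nonnegative outside another one is trivial. -/
theorem IsSimplicialCompleteFan.relation_eq_zero
    (hfan : IsSimplicialCompleteFan (fun i a => V a i) 𝓙) {J J' : Finset (Fin m)}
    (hJ : J ∈ 𝓙) (hJ' : J' ∈ 𝓙) {x : Fin m → ℝ} (hx : V *ᵥ x = 0)
    (hxJ : ∀ i ∉ J, x i ≤ 0) (hxJ' : ∀ i ∉ J', 0 ≤ x i) : x = 0 := by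
  obtain ⟨-, -, -, -, -, hli, hinter, -⟩ := hfan
  have hpos : ∀ i ∉ J, x⁺ i = 0 := fun i hi => by simp [Pi.posPart_apply, hxJ i hi]
  have hneg : ∀ i ∉ J', x⁻ i = 0 := fun i hi => by simp [Pi.negPart_apply, hxJ' i hi]
  have heq : V *ᵥ x⁺ = V *ᵥ x⁻ := by
    rw [← sub_eq_zero, ← Matrix.mulVec_sub, posPart_sub_negPart, hx]
  have hmem : V *ᵥ x⁺ ∈ coneOf (fun i a => V a i) (J ∩ J') := by
    rw [← hinter J hJ J' hJ']
    exact ⟨mem_coneOf_col.mpr ⟨x⁺, fun i => posPart_nonneg x i, hpos, rfl⟩,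
      mem_coneOf_col.mpr ⟨x⁻, fun i => negPart_nonneg x i, hneg, heq⟩⟩
  obtain ⟨c, -, hc, hxc⟩ := mem_coneOf_col.mp hmem
  have h₁ : x⁺ = c := eq_of_mulVec_eq_of_linearIndependent (hli J hJ) hpos
    (fun i hi => hc i (by simp [hi])) hxc
  have h₂ : x⁻ = c := eq_of_mulVec_eq_of_linearIndependent (hli J' hJ') hneg
    (fun i hi => hc i (by simp [hi])) (heq.symm.trans hxc)
  rw [← posPart_sub_negPart x, h₁, h₂, sub_self]

end Fan

/-- Vectors in an open half-plane are ordered by their slope. -/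
theorem exists_slope_of_pos {m : ℕ} {Q : Matrix (Fin 2) (Fin m) ℝ} {y : Fin 2 → ℝ}
    (hy : ∀ i, 0 < (y ᵥ* Q) i) :
    ∃ t : Fin m → ℝ, ∀ i j, t i ≤ t j ↔ 0 ≤ Q 0 i * Q 1 j - Q 1 i * Q 0 j := by
  simp only [Matrix.vecMul, dotProduct, Fin.sum_univ_two] at hy
  refine ⟨fun i => (y 0 * Q 1 i - y 1 * Q 0 i) / (y 0 * Q 0 i + y 1 * Q 1 i), fun i j => ?_⟩
  have hN : 0 < y 0 ^ 2 + y 1 ^ 2 := by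
    by_contra! h
    have h0 : y 0 = 0 := by nlinarith [sq_nonneg (y 0), sq_nonneg (y 1)]
    have h1 : y 1 = 0 := by nlinarith [sq_nonneg (y 0), sq_nonneg (y 1)]
    simpa [h0, h1] using hy i
  rw [div_le_div_iff₀ (hy i) (hy j), ← sub_nonneg,
    ← mul_nonneg_iff_of_pos_left (b := Q 0 i * Q 1 j - Q 1 i * Q 0 j) hN]
  ring_nf

/-- Cramer's rule: a planar vector lying between two others is in the cone they span. -/
theorem col_mem_coneOf_of_det {m : ℕ} {Q : Matrix (Fin 2) (Fin m) ℝ} {S : Finset (Fin m)}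
    {i j k : Fin m} (hi : i ∈ S) (hj : j ∈ S)
    (hij : 0 < Q 0 i * Q 1 j - Q 1 i * Q 0 j)
    (hik : 0 ≤ Q 0 i * Q 1 k - Q 1 i * Q 0 k)
    (hkj : 0 ≤ Q 0 k * Q 1 j - Q 1 k * Q 0 j) :
    (fun a => Q a k) ∈ coneOf (fun i a => Q a i) S := by
  have h := coneOf_add_mem
    (coneOf_smul_mem (div_nonneg hkj hij.le) (coneOf_generator_mem (fun i a => Q a i) hi))
    (coneOf_smul_mem (div_nonneg hik hij.le) (coneOf_generator_mem (fun i a => Q a i) hj))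
  convert h using 1
  ext a
  have hne := hij.ne'
  simp only [Pi.add_apply, Pi.smul_apply, smul_eq_mul]
  rw [div_mul_eq_mul_div, div_mul_eq_mul_div, ← add_div, eq_div_iff hne]
  fin_cases a <;> simp only [Fin.zero_eta, Fin.mk_one] <;> ring

theorem stmt_8 {n : ℕ} (hn : 1 ≤ n) {m : ℕ} (hm : m = n + 2)
    (V : Matrix (Fin n) (Fin m) ℝ) (Q : Matrix (Fin 2) (Fin m) ℝ)
    (𝓙 : Set (Finset (Fin m)))
    (hfan : IsSimplicialCompleteFan (fun i a => V a i) 𝓙)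
    (hQrank : Q.rank = 2) (hQV : Q * Vᵀ = 0)
    (𝓘 : Set (Finset (Fin m))) (h𝓘 : 𝓘 = {I | ∃ J ∈ 𝓙, I = Jᶜ}) :
    ∃ I₀ ∈ 𝓘, (⋂ I ∈ 𝓘, coneOf (fun i a => Q a i) I) = coneOf (fun i a => Q a i) I₀ := by
  have hker {x : Fin m → ℝ} (hx : V *ᵥ x = 0) : ∃ z, z ᵥ* Q = x :=
    exists_vecMul_eq_of_mulVec_eq_zero hQV (by rw [hQrank, hfan.rank_eq]; omega) hx
  obtain ⟨c, hc, hVc⟩ := hfan.exists_pos_relation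
  obtain ⟨y, rfl⟩ := hker hVc
  obtain ⟨t, ht⟩ := exists_slope_of_pos hc
  have ht' (i j : Fin m) : t i < t j ↔ 0 < Q 0 i * Q 1 j - Q 1 i * Q 0 j := by
    rw [← not_le, ht, not_le]
    constructor <;> intro h <;> linarith
  have hcard : ∀ I ∈ 𝓘, I.card = 2 := by
    rw [h𝓘]
    rintro _ ⟨J, hJ, rfl⟩
    rw [Finset.card_compl, hfan.2.2.2.1 J hJ, Fintype.card_fin]
    omega
  have hmin : ∀ I ∈ 𝓘, ∃ i ∈ I, ∀ k ∈ I, t i ≤ t k := fun I hI =>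
    Finset.exists_min_image I t (Finset.card_pos.mp (by rw [hcard I hI]; norm_num))
  have hmax : ∀ I ∈ 𝓘, ∃ i ∈ I, ∀ k ∈ I, t k ≤ t i := fun I hI =>
    Finset.exists_max_image I t (Finset.card_pos.mp (by rw [hcard I hI]; norm_num))
  have : Nonempty (Fin m) := ⟨⟨0, by omega⟩⟩
  choose! L hL hLle using hmin
  choose! R hR hRle using hmax
  have hLR : ∀ I ∈ 𝓘, ∀ I' ∈ 𝓘, t (L I) < t (R I') := by
    intro I hI I' hI'
    by_contra! hlt
    have hI₁ := hI
    have hI₁' := hI'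
    rw [h𝓘] at hI₁ hI₁'
    obtain ⟨J, hJ, hIJ⟩ := hI₁
    obtain ⟨J', hJ', hIJ'⟩ := hI₁'
    have hval (i : Fin m) : (![Q 1 (L I), -Q 0 (L I)] ᵥ* Q) i
        = Q 0 i * Q 1 (L I) - Q 1 i * Q 0 (L I) := by
      simp [Matrix.vecMul, dotProduct, Fin.sum_univ_two]
      ring
    have hzero := hfan.relation_eq_zero hJ hJ' (mulVec_vecMul_eq_zero hQV ![Q 1 (L I), -Q 0 (L I)])
      (fun i hi => by
        have := (ht _ _).mp (hLle I hI i (by simp [hIJ, hi]))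
        rw [hval]
        linarith)
      (fun i hi => by
        rw [hval]
        exact (ht _ _).mp ((hRle I' hI' i (by simp [hIJ', hi])).trans hlt))
    have hz := eq_zero_of_vecMul_eq_zero_of_rank_eq hQrank hzero
    have h0 : Q 1 (L I) = 0 := by simpa using congrFun hz 0
    have h1 : Q 0 (L I) = 0 := by simpa using congrFun hz 1
    have := hc (L I)
    simp [Matrix.vecMul, dotProduct, Fin.sum_univ_two, h0, h1] at this
  have hne : 𝓘.Nonempty := by
    obtain ⟨J, hJ⟩ := hfan.2.2.1
    exact ⟨Jᶜ, by rw [h𝓘]; exact ⟨J, hJ, rfl⟩⟩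
  obtain ⟨I₁, hI₁, hI₁max⟩ := Set.exists_max_image 𝓘 (fun I => t (L I)) 𝓘.toFinite hne
  obtain ⟨I₂, hI₂, hI₂min⟩ := Set.exists_min_image 𝓘 (fun I => t (R I)) 𝓘.toFinite hne
  have hlr := hLR I₁ hI₁ I₂ hI₂
  have hlrne : L I₁ ≠ R I₂ := fun h => hlr.ne (congrArg t h)
  have hcol : ∀ I ∈ 𝓘, ∀ k ∈ ({L I₁, R I₂} : Finset (Fin m)),
      (fun a => Q a k) ∈ coneOf (fun i a => Q a i) I := by
    intro I hI k hk
    refine col_mem_coneOf_of_det (hL I hI) (hR I hI) ((ht' _ _).mp (hLR I hI I hI))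
      ((ht _ _).mp ?_) ((ht _ _).mp ?_)
    · rcases Finset.mem_insert.mp hk with rfl | hk
      · exact hI₁max I hI
      · rw [Finset.mem_singleton.mp hk]
        exact (hLR I hI I₂ hI₂).le
    · rcases Finset.mem_insert.mp hk with rfl | hk
      · exact (hLR I₁ hI₁ I hI).le
      · rw [Finset.mem_singleton.mp hk]
        exact hI₂min I hI
  have hmem : ({L I₁, R I₂} : Finset (Fin m)) ∈ 𝓘 := by
    set I₀ : Finset (Fin m) := {L I₁, R I₂} with hI₀
    let a : Fin m → ℝ := fun i => if i ∈ I₀ then 0 else 1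
    obtain ⟨J, hJ, b, hb, hbJ, hab⟩ := hfan.exists_mem_coneOf (V *ᵥ a)
    have hJ𝓘 : Jᶜ ∈ 𝓘 := by rw [h𝓘]; exact ⟨J, hJ, rfl⟩
    obtain ⟨z, hz⟩ := hker (x := a - b) (by rw [Matrix.mulVec_sub, hab, sub_self])
    have hz' (i : Fin m) : z ⬝ᵥ (fun k => Q k i) = a i - b i := congrFun hz i
    have hb₀ : ∀ i ∈ I₀, a i - b i = 0 := by
      intro i hi
      refine le_antisymm (by simp [a, hi, hb i]) ?_
      rw [← hz']
      refine dotProduct_nonneg_of_mem_coneOf (hcol _ hJ𝓘 i hi) fun k hk => ?_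
      rw [hz', hbJ k (Finset.mem_compl.mp hk), sub_zero]
      by_cases h : k ∈ I₀ <;> simp [a, h]
    have hdet := (ht' _ _).mp hlr
    have hl := hb₀ (L I₁) (by simp [hI₀])
    have hr := hb₀ (R I₂) (by simp [hI₀])
    rw [← hz'] at hl hr
    simp only [dotProduct, Fin.sum_univ_two] at hl hr
    have hz0 : z 0 = 0 := by
      refine (mul_eq_zero.mp ?_).resolve_right hdet.ne'
      linear_combination Q 1 (R I₂) * hl - Q 1 (L I₁) * hr
    have hz1 : z 1 = 0 := by
      refine (mul_eq_zero.mp ?_).resolve_right hdet.ne'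
      linear_combination Q 0 (L I₁) * hr - Q 0 (R I₂) * hl
    have hsub : Jᶜ ⊆ I₀ := by
      intro i hi
      by_contra h
      have := hz' i
      simp [dotProduct, Fin.sum_univ_two, hz0, hz1, a, h, hbJ i (Finset.mem_compl.mp hi)] at this
    rw [← Finset.eq_of_subset_of_card_le hsub
      (by rw [hcard _ hJ𝓘, hI₀, Finset.card_pair hlrne])]
    exact hJ𝓘
  exact ⟨_, hmem, Set.Subset.antisymm (Set.biInter_subset_of_mem hmem)
    (Set.subset_iInter₂ fun I hI => coneOf_subset_coneOf (hcol I hI))⟩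
end
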